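/- arXiv:2407.20620 — 2 statements merged into one kernel-verified Lean document; each statement's English description precedes it below -/
import Mathlib

section
/- Let f(x) = (1/2)⟨x, Qx⟩ + ⟨q, x⟩ with Q symmetric positive semidefinite with largest eigenvalue L > 0, let g : ℝⁿ → ℝ be convex and lower semicontinuous, and let μ ∈ (0, 1/L) and α > 0. Set γ(t) = 3/(t+3) and β(t) = 1 − γ(t). Then there exists a constant c₁ > 0, depending only on Q, q, g, μ, α, such that for every twice continuously differentiable z : [0,∞) → ℝⁿ satisfying z̈(t) + γ(t)ż(t) + α G_μ(prox_{μf}(z(t) + β(t)ż(t))) = 0 for all t ≥ 0, with x(t) := prox_{μf}(z(t)) (which is differentiable in t), every minimizer x⋆ of F = f + g, and every t ≥ 0: F(p_μ(x(t))) − F(x⋆) ≤ c₁ (‖x(0) − x⋆‖² + ‖ẋ(0)‖²)/(t+3)². -/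
open Set RealInnerProductSpace

noncomputable section

section Helpers

variable {E : Type*} [NormedAddCommGroup E] [InnerProductSpace ℝ E]

/-- A continuous selection of subgradients is a gradient. -/
theorem aux_hasGradientAt [CompleteSpace E] (H : E → ℝ) (D : E → E) (x : E)
    (hsub : ∀ x y, H x + ⟪D x, y - x⟫ ≤ H y) (hc : ContinuousAt D x) :
    HasGradientAt H (D x) x := by
  rw [hasGradientAt_iff_isLittleO]
  rw [Asymptotics.isLittleO_iff]
  intro ε hε
  have h1 : ∀ᶠ y in nhds x, ‖D y - D x‖ < ε := by
    have := Metric.continuousAt_iff'.mp hc ε hε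
    simpa [dist_eq_norm] using this
  filter_upwards [h1] with y hy
  have h2 := hsub x y
  have h3 := hsub y x
  have h4 : ⟪D y - D x, y - x⟫ ≤ ‖D y - D x‖ * ‖y - x‖ := real_inner_le_norm _ _
  have h5 : ⟪D y - D x, y - x⟫ = ⟪D y, y - x⟫ - ⟪D x, y - x⟫ := inner_sub_left _ _ _
  have h6 : ⟪D y, x - y⟫ = - ⟪D y, y - x⟫ := by
    rw [← inner_neg_right, neg_sub]
  have h7 : ‖D y - D x‖ * ‖y - x‖ ≤ ε * ‖y - x‖ :=
    mul_le_mul_of_nonneg_right hy.le (norm_nonneg _)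
  rw [Real.norm_eq_abs, abs_of_nonneg (by linarith)]
  linarith

/-- Variational characterization of the proximal point. -/
theorem aux_prox (g : E → ℝ) (hg : ConvexOn ℝ univ g) (μ : ℝ) (hμ : 0 < μ) (v p : E)
    (hp : IsMinOn (fun z => g z + ‖z - v‖ ^ 2 / (2 * μ)) univ p) (z : E) :
    g p + μ⁻¹ * ⟪v - p, z - p⟫ ≤ g z := by
  have key : ∀ s : ℝ, 0 < s → s < 1 →
      g p + μ⁻¹ * ⟪v - p, z - p⟫ ≤ g z + s * (‖z - p‖ ^ 2 / (2 * μ)) := by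
    intro s hs hs1
    have h1 := hg.2 (mem_univ p) (mem_univ z) (by linarith : (0:ℝ) ≤ 1 - s) hs.le (by ring)
    have h2 : g p + ‖p - v‖ ^ 2 / (2 * μ) ≤
        g ((1 - s) • p + s • z) + ‖((1 - s) • p + s • z) - v‖ ^ 2 / (2 * μ) :=
      isMinOn_iff.mp hp _ (mem_univ _)
    have h3 : ((1 - s) • p + s • z) - v = s • (z - p) - (v - p) := by module
    have h4 : p - v = -(v - p) := by abel
    rw [h3, h4, norm_neg, norm_sub_sq_real (s • (z - p)) (v - p), norm_smul, inner_smul_left] at h2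
    simp only [smul_eq_mul, Real.norm_eq_abs, mul_pow, sq_abs] at h1 h2
    simp only [conj_trivial] at h2
    rw [real_inner_comm (v - p) (z - p)] at h2
    have h5 : s * (g p + μ⁻¹ * ⟪v - p, z - p⟫) ≤ s * (g z + s * (‖z - p‖ ^ 2 / (2 * μ))) := by
      have e : (s ^ 2 * ‖z - p‖ ^ 2 - 2 * (s * ⟪v - p, z - p⟫) + ‖v - p‖ ^ 2) / (2 * μ)
        = s * (s * (‖z - p‖ ^ 2 / (2 * μ))) - s * (μ⁻¹ * ⟪v - p, z - p⟫)
          + ‖v - p‖ ^ 2 / (2 * μ) := by field_simp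
      rw [e] at h2
      nlinarith
    exact le_of_mul_le_mul_left h5 hs
  have hlim : Filter.Tendsto (fun s : ℝ => g z + s * (‖z - p‖ ^ 2 / (2 * μ)))
      (nhdsWithin 0 (Ioi 0)) (nhds (g z + 0 * (‖z - p‖ ^ 2 / (2 * μ)))) := by
    apply Filter.Tendsto.mono_left _ nhdsWithin_le_nhds
    exact Continuous.tendsto (by fun_prop) 0
  rw [zero_mul, add_zero] at hlim
  refine ge_of_tendsto hlim ?_
  filter_upwards [Ioo_mem_nhdsGT (zero_lt_one' ℝ)] with s hs
  exact key s hs.1 hs.2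

/-- The proximal map is continuous. -/
theorem aux_prox_cont (g : E → ℝ) (hg : ConvexOn ℝ univ g) (μ : ℝ) (hμ : 0 < μ) (P : E → E)
    (hP : ∀ v, IsMinOn (fun z => g z + ‖z - v‖ ^ 2 / (2 * μ)) univ (P v)) :
    Continuous P := by
  have : LipschitzWith 1 P := by
    refine LipschitzWith.of_dist_le_mul fun u v => ?_
    have h1 := aux_prox g hg μ hμ u (P u) (hP u) (P v)
    have h2 := aux_prox g hg μ hμ v (P v) (hP v) (P u)
    have h3 : ⟪u - P u, P v - P u⟫ + ⟪v - P v, P u - P v⟫ ≤ 0 := by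
      have : μ⁻¹ * (⟪u - P u, P v - P u⟫ + ⟪v - P v, P u - P v⟫) ≤ 0 := by linarith
      have hi : 0 < μ⁻¹ := inv_pos.mpr hμ
      by_contra hcon
      push Not at hcon
      nlinarith [mul_pos hi hcon]
    have h4 : ⟪u - P u, P v - P u⟫ + ⟪v - P v, P u - P v⟫
        = ‖P u - P v‖ ^ 2 - ⟪u - v, P u - P v⟫ := by
      rw [← real_inner_self_eq_norm_sq]
      simp only [inner_sub_left, inner_sub_right]
      ring
    have h5 := real_inner_le_norm (u - v) (P u - P v)
    rw [dist_eq_norm, dist_eq_norm]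
    simp only [NNReal.coe_one, one_mul]
    by_contra hcon
    push Not at hcon
    nlinarith [norm_nonneg (u - v)]
  exact this.continuous

/-- The abstract Lyapunov argument. -/
theorem aux_lyapunov [CompleteSpace E] (Q : E →L[ℝ] E) (μ α : ℝ) (hα : 0 < α)
    (hQsym : ∀ x y : E, ⟪Q x, y⟫ = ⟪x, Q y⟫)
    (hB : ∀ u : E, 0 ≤ ⟪u, u + μ • Q u⟫)
    (hA : ∀ u : E, 0 ≤ ⟪u, u - μ • Q u⟫)
    (H : E → ℝ) (D G : E → E) (hD : ∀ x, D x = G x - μ • Q (G x))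
    (hsub : ∀ x y, H x + ⟪D x, y - x⟫ ≤ H y)
    (hgrad : ∀ x, HasGradientAt H (D x) x)
    (xs : E) (Fs : ℝ) (hxs : ∀ x, H x + ⟪D x, xs - x⟫ ≤ Fs)
    (x xv xa : ℝ → E)
    (hx : ∀ t ∈ Ici (0 : ℝ), HasDerivWithinAt x (xv t) (Ici 0) t)
    (hxv : ∀ t ∈ Ici (0 : ℝ), HasDerivWithinAt xv (xa t) (Ici 0) t)
    (hode : ∀ t ∈ Ici (0 : ℝ), xa t + μ • Q (xa t) + (3 / (t + 3)) • (xv t + μ • Q (xv t))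
      + α • G (x t + (1 - 3 / (t + 3)) • xv t) = 0)
    (t : ℝ) (ht : 0 ≤ t) :
    α * (t + 3) ^ 2 * (H (x t) - Fs) ≤ α * 9 * (H (x 0) - Fs)
      + (1 / 2) * ‖(2 : ℝ) • (x 0 - xs) + (3 : ℝ) • xv 0‖ ^ 2 := by
  set ζ : ℝ → E := fun t => (2 : ℝ) • (x t - xs) + (t + 3) • xv t with hζ
  set S : E → E := fun u => u - μ • μ • Q (Q u) with hS
  set V : ℝ → ℝ := fun t => α * (t + 3) ^ 2 * (H (x t) - Fs) + (1 / 2) * ⟪ζ t, S (ζ t)⟫ with hV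
  have hSpos : ∀ u, 0 ≤ ⟪u, S u⟫ := by
    intro u
    have h1 := hB (u - μ • Q u)
    have h2 := hA (u + μ • Q u)
    have h3 : ⟪u - μ • Q u, (u - μ • Q u) + μ • Q (u - μ • Q u)⟫
      + ⟪u + μ • Q u, (u + μ • Q u) - μ • Q (u + μ • Q u)⟫ = 2 * ⟪u, S u⟫ := by
      simp only [hS, map_add, map_sub, map_smul, inner_add_left, inner_add_right, inner_sub_left,
        inner_sub_right, inner_smul_left, inner_smul_right, hQsym, conj_trivial]
      ring
    linarith
  have hSle : ∀ u, ⟪u, S u⟫ ≤ ‖u‖ ^ 2 := by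
    intro u
    have : ⟪u, S u⟫ = ‖u‖ ^ 2 - μ ^ 2 * ‖Q u‖ ^ 2 := by
      rw [← real_inner_self_eq_norm_sq, ← real_inner_self_eq_norm_sq]
      simp only [hS, inner_sub_right, inner_smul_right, hQsym]
      ring
    rw [this]
    have : 0 ≤ μ ^ 2 * ‖Q u‖ ^ 2 := by positivity
    linarith
  have hderiv : ∀ s ∈ Ici (0 : ℝ), HasDerivWithinAt V
      (α * (2 * (s + 3)) * (H (x s) - Fs) + α * (s + 3) ^ 2 * ⟪D (x s), xv s⟫
        + ⟪ζ s, S ((3 : ℝ) • xv s + (s + 3) • xa s)⟫) (Ici 0) s := by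
    intro s hs
    have hid : HasDerivWithinAt (fun t : ℝ => t + 3) 1 (Ici 0) s :=
      (hasDerivWithinAt_id s _).add_const 3
    have d1 : HasDerivWithinAt (fun t => H (x t)) ⟪D (x s), xv s⟫ (Ici 0) s := by
      have := (hgrad (x s)).hasFDerivAt.comp_hasDerivWithinAt s (hx s hs)
      exact this.congr_deriv (by simp)
    have d2 : HasDerivWithinAt ζ ((3 : ℝ) • xv s + (s + 3) • xa s) (Ici 0) s := by
      have := (((hx s hs).sub_const xs).const_smul (2 : ℝ)).add (hid.smul (hxv s hs))
      refine this.congr_deriv ?_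
      module
    have d3 : HasDerivWithinAt (fun t => S (ζ t)) (S ((3 : ℝ) • xv s + (s + 3) • xa s))
        (Ici 0) s := by
      have e := (Q.hasFDerivAt.comp_hasDerivWithinAt s (Q.hasFDerivAt.comp_hasDerivWithinAt s d2))
      exact d2.sub ((e.const_smul μ).const_smul μ)
    have d4 := ((hid.pow 2).const_mul α).mul (d1.sub_const Fs)
    have d5 := (d2.inner ℝ d3).const_mul (1 / 2)
    refine (d4.add d5).congr_deriv ?_
    have e1 : ∀ u w, ⟪u, S w⟫ = ⟪w, S u⟫ := by
      intro u w
      have k1 : ⟪u, Q (Q w)⟫ = ⟪w, Q (Q u)⟫ := by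
        rw [← hQsym, ← hQsym, real_inner_comm]
      simp only [hS, inner_sub_right, inner_smul_right, k1]
      rw [real_inner_comm]
    rw [e1 ((3 : ℝ) • xv s + (s + 3) • xa s) (ζ s)]
    simp
    ring
  have hle : ∀ s ∈ Ici (0 : ℝ), α * (2 * (s + 3)) * (H (x s) - Fs)
      + α * (s + 3) ^ 2 * ⟪D (x s), xv s⟫
        + ⟪ζ s, S ((3 : ℝ) • xv s + (s + 3) • xa s)⟫ ≤ 0 := by
    intro s hs
    have hs0 : (0 : ℝ) ≤ s := hs
    have ho := hode s hs
    set b : ℝ := 1 - 3 / (s + 3) with hb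
    set y : E := x s + b • xv s with hy
    have hs3 : 0 < s + 3 := by linarith
    have hbτ : b * (s + 3) = s := by rw [hb]; field_simp; ring
    have hb0 : 0 ≤ b := by
      have : 3 / (s + 3) ≤ 1 := by rw [div_le_one hs3]; linarith
      linarith
    have hb1 : b ≤ 1 := by
      have : 0 ≤ 3 / (s + 3) := by positivity
      linarith
    have e0 : (3 : ℝ) • (xv s + μ • Q (xv s)) + (s + 3) • (xa s + μ • Q (xa s))
        = -((α * (s + 3)) • G y) := by
      have h3 : (s + 3) • (3 / (s + 3)) • (xv s + μ • Q (xv s))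
          = (3 : ℝ) • (xv s + μ • Q (xv s)) := by
        rw [smul_smul]; congr 1; field_simp
      have h4 := congrArg (fun u => (s + 3) • u) ho
      simp only [smul_add (s + 3), smul_zero] at h4
      rw [eq_neg_iff_add_eq_zero, ← h4]
      simp only [← smul_add (s + 3)]
      rw [← h3]
      module
    have e1 : S ((3 : ℝ) • xv s + (s + 3) • xa s) = -((α * (s + 3)) • D y) := by
      have h1 : S ((3 : ℝ) • xv s + (s + 3) • xa s) =
        ((3 : ℝ) • (xv s + μ • Q (xv s)) + (s + 3) • (xa s + μ • Q (xa s)))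
        - μ • Q ((3 : ℝ) • (xv s + μ • Q (xv s)) + (s + 3) • (xa s + μ • Q (xa s))) := by
        simp only [hS, map_add, map_smul]
        module
      rw [h1, e0, hD]
      simp only [map_neg, map_smul]
      module
    rw [e1, inner_neg_right, inner_smul_right, real_inner_comm (D y) (ζ s)]
    have e2 : ζ s = -((2 : ℝ) • (xs - y)) + (s + 3 - 2 * b) • xv s := by
      simp only [hζ, hy]; module
    rw [e2, inner_add_right, inner_neg_right, inner_smul_right, inner_smul_right]
    have i1 := hxs y
    have i2 := hsub (x s) y
    have i3 := hsub y (x s)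
    have e3 : y - x s = b • xv s := by simp [hy]
    have e4 : x s - y = -(b • xv s) := by rw [← e3]; abel
    rw [e3, inner_smul_right] at i2
    rw [e4, inner_neg_right, inner_smul_right] at i3
    have hmono : ⟪D (x s), xv s⟫ ≤ ⟪D y, xv s⟫ := by
      rcases hb0.eq_or_lt with h | h
      · have : y = x s := by simp [hy, ← h]
        rw [this]
      · have : b * ⟪D (x s), xv s⟫ ≤ b * ⟪D y, xv s⟫ := by linarith
        exact le_of_mul_le_mul_left this h
    have j1 : 0 ≤ (s + 3) * (s + 3 - 2 * b) * (⟪D y, xv s⟫ - ⟪D (x s), xv s⟫) := by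
      have : 0 ≤ s + 3 - 2 * b := by linarith
      have hdiff : 0 ≤ ⟪D y, xv s⟫ - ⟪D (x s), xv s⟫ := by linarith
      positivity
    have j2 : 0 ≤ (s + 3) * (Fs - H (x s) - b * ⟪D (x s), xv s⟫ - ⟪D y, xs - y⟫) :=
      mul_nonneg hs3.le (by linarith)
    have j3 : 0 ≤ α * ((s + 3) * (s + 3 - 2 * b) * (⟪D y, xv s⟫ - ⟪D (x s), xv s⟫)
      + 2 * ((s + 3) * (Fs - H (x s) - b * ⟪D (x s), xv s⟫ - ⟪D y, xs - y⟫))) :=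
      mul_nonneg hα.le (by linarith)
    linarith
  have hanti : AntitoneOn V (Ici 0) := by
    refine antitoneOn_of_hasDerivWithinAt_nonpos (convex_Ici 0)
      (fun s hs => (hderiv s hs).continuousWithinAt)
      (fun s hs => (hderiv s (interior_subset hs)).mono interior_subset)
      (fun s hs => hle s (interior_subset hs))
  have hfin := hanti (mem_Ici.mpr le_rfl) (mem_Ici.mpr ht) ht
  have h1 := hSpos (ζ t)
  have h2 := hSle (ζ 0)
  have h3 : ζ 0 = (2 : ℝ) • (x 0 - xs) + (3 : ℝ) • xv 0 := by simp [hζ]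
  simp only [hV] at hfin
  rw [h3] at h2 hfin
  norm_num at hfin ⊢
  linarith

end Helpers

/-- Theorem 1, Douglas–Rachford case: accelerated sublinear
convergence of the accelerated Douglas–Rachford splitting dynamics for a convex
quadratic `f` plus a convex lower semicontinuous `g`. -/
theorem accelerated_DR_convex_quadratic {n : ℕ}
    (Q : EuclideanSpace ℝ (Fin n) →L[ℝ] EuclideanSpace ℝ (Fin n))
    (q : EuclideanSpace ℝ (Fin n)) (g : EuclideanSpace ℝ (Fin n) → ℝ)
    (L μ α : ℝ)
    (hQsym : ∀ x y : EuclideanSpace ℝ (Fin n), ⟪Q x, y⟫ = ⟪x, Q y⟫)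
    (hQpsd : ∀ x : EuclideanSpace ℝ (Fin n), 0 ≤ ⟪x, Q x⟫)
    (hL : 0 < L)
    (hQL : ∀ x : EuclideanSpace ℝ (Fin n), ⟪x, Q x⟫ ≤ L * ‖x‖ ^ 2)
    (hQLmax : ∃ x : EuclideanSpace ℝ (Fin n), x ≠ 0 ∧ ⟪x, Q x⟫ = L * ‖x‖ ^ 2)
    (f F : EuclideanSpace ℝ (Fin n) → ℝ)
    (hf : ∀ x, f x = (1 / 2) * ⟪x, Q x⟫ + ⟪q, x⟫)
    (hF : ∀ x, F x = f x + g x)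
    (hgconv : ConvexOn ℝ univ g) (hglsc : LowerSemicontinuous g)
    (hμ : μ ∈ Ioo 0 (1 / L)) (hα : 0 < α)
    (proxg proxf : EuclideanSpace ℝ (Fin n) → EuclideanSpace ℝ (Fin n))
    (hproxg : ∀ v, IsMinOn (fun z => g z + ‖z - v‖ ^ 2 / (2 * μ)) univ (proxg v))
    (hproxf : ∀ v, IsMinOn (fun z => f z + ‖z - v‖ ^ 2 / (2 * μ)) univ (proxf v))
    (G p : EuclideanSpace ℝ (Fin n) → EuclideanSpace ℝ (Fin n))
    (hG : ∀ x, G x = μ⁻¹ • (x - proxg (x - μ • gradient f x)))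
    (hp : ∀ x, p x = proxg (x - μ • gradient f x))
    (γ β : ℝ → ℝ)
    (hγ : ∀ t, γ t = 3 / (t + 3)) (hβ : ∀ t, β t = 1 - γ t) :
    ∃ c > (0 : ℝ), ∀ z v a xv : ℝ → EuclideanSpace ℝ (Fin n),
      (∀ t ∈ Ici (0 : ℝ), HasDerivWithinAt z (v t) (Ici 0) t) →
      (∀ t ∈ Ici (0 : ℝ), HasDerivWithinAt v (a t) (Ici 0) t) →
      ContinuousOn a (Ici 0) →
      (∀ t ∈ Ici (0 : ℝ), a t + γ t • v t + α • G (proxf (z t + β t • v t)) = 0) →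
      (∀ t ∈ Ici (0 : ℝ), HasDerivWithinAt (fun s => proxf (z s)) (xv t) (Ici 0) t) →
      ∀ xs, IsMinOn F univ xs →
        ∀ t ∈ Ici (0 : ℝ),
          F (p (proxf (z t))) - F xs ≤
            c * (‖proxf (z 0) - xs‖ ^ 2 + ‖xv 0‖ ^ 2) / (t + 3) ^ 2 := by
  classical
  obtain ⟨hμ0, hμ1⟩ := hμ
  have hμL : μ * L < 1 := by rwa [lt_div_iff₀ hL] at hμ1
  have hA : ∀ u : EuclideanSpace ℝ (Fin n), 0 ≤ ⟪u, u - μ • Q u⟫ := by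
    intro u
    rw [inner_sub_right, inner_smul_right, real_inner_self_eq_norm_sq]
    have := mul_le_mul_of_nonneg_left (hQL u) hμ0.le
    nlinarith [sq_nonneg ‖u‖]
  have hBn : ∀ u : EuclideanSpace ℝ (Fin n), ‖u‖ ^ 2 ≤ ⟪u, u + μ • Q u⟫ := by
    intro u
    rw [inner_add_right, inner_smul_right, real_inner_self_eq_norm_sq]
    have := mul_nonneg hμ0.le (hQpsd u)
    linarith
  have hB : ∀ u : EuclideanSpace ℝ (Fin n), 0 ≤ ⟪u, u + μ • Q u⟫ :=
    fun u => le_trans (sq_nonneg _) (hBn u)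
  -- exact expansion of `f`
  have hfexp : ∀ x y, f y = f x + ⟪Q x + q, y - x⟫ + (1 / 2) * ⟪y - x, Q (y - x)⟫ := by
    intro x y
    rw [hf, hf]
    have h1 : ⟪x, Q y⟫ = ⟪Q x, y⟫ := (hQsym x y).symm
    have h2 : ⟪y, Q x⟫ = ⟪Q x, y⟫ := real_inner_comm _ _
    have h3 : ⟪Q x, x⟫ = ⟪x, Q x⟫ := real_inner_comm _ _
    simp only [map_sub, inner_add_left, inner_sub_left, inner_sub_right, h1, h2, h3]
    ring
  have hgradf : ∀ x, gradient f x = Q x + q := by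
    intro x
    refine (aux_hasGradientAt f (fun x => Q x + q) x ?_ ?_).gradient
    · intro x y
      rw [hfexp x y]
      have := hQpsd (y - x)
      linarith
    · fun_prop
  -- optimality for proxf
  have hpf : ∀ w, proxf w + μ • Q (proxf w) = w - μ • q := by
    intro w
    set x := proxf w with hx
    set r := w - μ • q - (x + μ • Q x) with hr
    have h1 : f x + ‖x - w‖ ^ 2 / (2 * μ) ≤
        f (x + (1 / 2 : ℝ) • r) + ‖(x + (1 / 2 : ℝ) • r) - w‖ ^ 2 / (2 * μ) :=
      isMinOn_iff.mp (hproxf w) _ (mem_univ _)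
    rw [hfexp x (x + (1 / 2 : ℝ) • r)] at h1
    have e1 : x + (1 / 2 : ℝ) • r - x = (1 / 2 : ℝ) • r := by abel
    have e2 : x + (1 / 2 : ℝ) • r - w = (x - w) + (1 / 2 : ℝ) • r := by abel
    rw [e1, e2, @norm_add_sq_real, norm_smul] at h1
    simp only [map_smul, inner_smul_left, inner_smul_right, conj_trivial, mul_pow,
      Real.norm_eq_abs, sq_abs] at h1
    have e3 : μ * ⟪Q x + q, r⟫ + ⟪x - w, r⟫ = - ‖r‖ ^ 2 := by
      rw [← real_inner_self_eq_norm_sq, ← inner_neg_left, ← real_inner_smul_left, ← inner_add_left]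
      congr 1
      rw [hr]; module
    have h2 := hQL r
    have h3 : 0 ≤ μ * ((1/2) * ⟪Q x + q, r⟫ + (1 / 8) * ⟪r, Q r⟫)
        + (1/2) * (⟪x - w, r⟫ + (1/4) * ‖r‖ ^ 2) := by
      have e4 : (‖x - w‖ ^ 2 + 2 * (1 / 2 * ⟪x - w, r⟫) + (1 / 2) ^ 2 * ‖r‖ ^ 2) / (2 * μ)
        = ‖x - w‖ ^ 2 / (2 * μ) + μ⁻¹ * ((1/2) * (⟪x - w, r⟫ + (1/4) * ‖r‖ ^ 2)) := by
        field_simp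
        ring
      rw [e4] at h1
      have h5 : 0 ≤ μ * (((1/2) * ⟪Q x + q, r⟫ + (1 / 8) * ⟪r, Q r⟫)
        + μ⁻¹ * ((1/2) * (⟪x - w, r⟫ + (1/4) * ‖r‖ ^ 2))) :=
        mul_nonneg hμ0.le (by linarith)
      rw [mul_add, mul_inv_cancel_left₀ hμ0.ne'] at h5
      exact h5
    have h4 := mul_le_mul_of_nonneg_left h2 hμ0.le
    have h5 : ‖r‖ ^ 2 ≤ 0 := by nlinarith [sq_nonneg ‖r‖]
    have h6 : r = 0 := by
      have : ‖r‖ = 0 := by nlinarith [norm_nonneg r]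
      simpa using this
    rw [hr, sub_eq_zero] at h6
    exact h6.symm
  -- inverse of `B = 1 + μ Q`
  let B : EuclideanSpace ℝ (Fin n) →L[ℝ] EuclideanSpace ℝ (Fin n) :=
    ContinuousLinearMap.id ℝ _ + μ • Q
  have hBap : ∀ u, B u = u + μ • Q u := fun u => by simp [B]
  have hBinj : Function.Injective B := by
    rw [injective_iff_map_eq_zero]
    intro u hu
    have := hBn u
    rw [← hBap, hu, inner_zero_right] at this
    have : ‖u‖ = 0 := by nlinarith [norm_nonneg u]
    simpa using this
  let e := LinearEquiv.ofInjectiveEndo (B : EuclideanSpace ℝ (Fin n) →ₗ[ℝ] _) hBinj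
  let M : EuclideanSpace ℝ (Fin n) →L[ℝ] EuclideanSpace ℝ (Fin n) :=
    LinearMap.toContinuousLinearMap (e.symm : EuclideanSpace ℝ (Fin n) →ₗ[ℝ] _)
  have hBM : ∀ u, B (M u) = u := fun u => e.apply_symm_apply u
  have hMB : ∀ u, M (B u) = u := fun u => hBinj (hBM _)
  have hpfM : ∀ w, proxf w = M (w - μ • q) := by
    intro w
    rw [← hpf, ← hBap, hMB]
  -- subgradient inequality for `F` at `p x`
  have hpG : ∀ x, x - p x = μ • G x := by
    intro x
    rw [hG, hp, smul_inv_smul₀ hμ0.ne']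
  have hFsub : ∀ x z, F (p x) + ⟪G x - μ • Q (G x), z - p x⟫ ≤ F z := by
    intro x z
    have h1 := aux_prox g hgconv μ hμ0 _ _ (hproxg (x - μ • gradient f x)) z
    rw [← hp, hgradf, ← real_inner_smul_left] at h1
    have h2 := hfexp (p x) z
    have h3 := hQpsd (z - p x)
    rw [hF, hF]
    have e1 : G x - μ • Q (G x)
        = μ⁻¹ • (x - μ • (Q x + q) - p x) + (Q (p x) + q) := by
      have e2 : x = p x + μ • G x := by rw [← hpG]; abel
      have e3 : Q x = Q (p x) + μ • Q (G x) := by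
        conv_lhs => rw [e2]
        simp
      have e4 : x - μ • (Q x + q) - p x = μ • (G x - (Q x + q)) := by
        rw [smul_sub, ← hpG]; abel
      rw [e4, inv_smul_smul₀ hμ0.ne', e3]
      abel
    rw [e1, inner_add_left]
    linarith
  set D : EuclideanSpace ℝ (Fin n) → EuclideanSpace ℝ (Fin n) :=
    fun x => G x - μ • Q (G x) with hD
  set H : EuclideanSpace ℝ (Fin n) → ℝ := fun x => F (p x) + (μ / 2) * ⟪G x, D x⟫ with hH
  have hHsub : ∀ x y, H x + ⟪D x, y - x⟫ ≤ H y := by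
    intro x y
    have h1 := hFsub x (p y)
    have h2 := hA (G y - G x)
    have e1 : p y - p x = (y - x) - μ • (G y - G x) := by
      rw [smul_sub, ← hpG, ← hpG]; abel
    rw [e1, inner_sub_right, inner_smul_right] at h1
    have e2 : ⟪G y - G x, (G y - G x) - μ • Q (G y - G x)⟫
        = ⟪G y, D y⟫ + ⟪G x, D x⟫ - 2 * ⟪D x, G y⟫ := by
      have h5 : ⟪G x, Q (G y)⟫ = ⟪Q (G x), G y⟫ := (hQsym _ _).symm
      have h6 : ⟪G y, Q (G x)⟫ = ⟪Q (G x), G y⟫ := real_inner_comm _ _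
      have h7 : ⟪G y, G x⟫ = ⟪G x, G y⟫ := real_inner_comm _ _
      simp only [hD, map_sub, smul_sub, inner_sub_left, inner_sub_right, inner_smul_left,
        inner_smul_right, conj_trivial, h5, h6, h7]
      ring
    have e3 : ⟪D x, G y - G x⟫ = ⟪D x, G y⟫ - ⟪G x, D x⟫ := by
      rw [inner_sub_right, real_inner_comm (G x) (D x)]
    rw [e2] at h2
    have h1n : F (p x) + (⟪D x, y - x⟫ - μ * ⟪D x, G y - G x⟫) ≤ F (p y) := h1
    rw [e3] at h1n
    have h3 := mul_nonneg hμ0.le h2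
    simp only [hH]
    linarith
  have hGc : Continuous G := by
    have hc := aux_prox_cont g hgconv μ hμ0 proxg hproxg
    have : G = fun x => μ⁻¹ • (x - proxg (x - μ • (Q x + q))) := by
      funext x; rw [hG, hgradf]
    rw [this]
    fun_prop
  have hHgrad : ∀ x, HasGradientAt H (D x) x := fun x =>
    aux_hasGradientAt H D x hHsub (by
      have : Continuous D := by rw [hD]; fun_prop
      exact this.continuousAt)
  have hxsD : ∀ xs x, H x + ⟪D x, xs - x⟫ ≤ F xs - (μ / 2) * ⟪G x, D x⟫ := by
    intro xs x
    have h1 : F (p x) + ⟪D x, xs - p x⟫ ≤ F xs := hFsub x xs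
    have e1 : xs - p x = (xs - x) + μ • G x := by rw [← hpG]; abel
    rw [e1, inner_add_right, inner_smul_right, real_inner_comm (G x) (D x)] at h1
    simp only [hH]
    linarith
  have hGD : ∀ x, 0 ≤ (μ / 2) * ⟪G x, D x⟫ := fun x => mul_nonneg (by linarith) (hA (G x))
  -- upper bound on `H`
  have hHup : ∀ xs x, H x ≤ F xs + ‖x - xs‖ ^ 2 / (2 * μ) := by
    intro xs x
    have h1 := hxsD xs x
    set w := x - xs with hw
    have e0 : xs - x = -w := by rw [hw]; abel
    rw [e0, inner_neg_right] at h1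
    -- use positivity at `G x - μ⁻¹ w`
    have h2 := hA (G x - μ⁻¹ • w)
    have h8 := hQpsd w
    have e2 : ⟪G x - μ⁻¹ • w, (G x - μ⁻¹ • w) - μ • Q (G x - μ⁻¹ • w)⟫
        = ⟪G x, D x⟫ - 2 * μ⁻¹ * ⟪D x, w⟫ + μ⁻¹ ^ 2 * (‖w‖ ^ 2 - μ * ⟪w, Q w⟫) := by
      have h5 : ⟪G x, Q w⟫ = ⟪Q (G x), w⟫ := (hQsym _ _).symm
      have h6 : ⟪w, Q (G x)⟫ = ⟪Q (G x), w⟫ := real_inner_comm _ _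
      have h7 : ⟪w, G x⟫ = ⟪G x, w⟫ := real_inner_comm _ _
      rw [← real_inner_self_eq_norm_sq]
      simp only [hD, map_sub, map_smul, smul_sub, inner_sub_left, inner_sub_right,
        inner_smul_left, inner_smul_right, conj_trivial, h5, h6, h7]
      ring
    rw [e2] at h2
    have h3 : 0 ≤ (μ / 2) * (⟪G x, D x⟫ - 2 * μ⁻¹ * ⟪D x, w⟫
        + μ⁻¹ ^ 2 * (‖w‖ ^ 2 - μ * ⟪w, Q w⟫)) := mul_nonneg (by linarith) h2
    have e3 : (μ / 2) * (⟪G x, D x⟫ - 2 * μ⁻¹ * ⟪D x, w⟫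
        + μ⁻¹ ^ 2 * (‖w‖ ^ 2 - μ * ⟪w, Q w⟫))
        = (μ / 2) * ⟪G x, D x⟫ - ⟪D x, w⟫ + ‖w‖ ^ 2 / (2 * μ) - (1 / 2) * ⟪w, Q w⟫ := by
      field_simp
      ring
    rw [e3] at h3
    linarith
  refine ⟨9 / (2 * μ) + 9 / α, by positivity, ?_⟩
  intro z v a xv hz hv _ hode hx xs _ t ht
  have ht0 : (0 : ℝ) ≤ t := ht
  have hxvM : ∀ s ∈ Ici (0 : ℝ), xv s = M (v s) := by
    intro s hs
    have h1 : HasDerivWithinAt (fun s => proxf (z s)) (M (v s)) (Ici 0) s := by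
      have := M.hasFDerivAt.comp_hasDerivWithinAt s ((hz s hs).sub_const (μ • q))
      refine this.congr_of_mem (fun u _ => ?_) hs
      exact hpfM _
    exact UniqueDiffWithinAt.eq_deriv _ (uniqueDiffOn_Ici (0 : ℝ) s hs) (hx s hs) h1
  have hmain := aux_lyapunov Q μ α hα hQsym hB hA H D G (fun x => rfl) hHsub hHgrad xs (F xs)
    (fun x => by have := hxsD xs x; have := hGD x; linarith)
    (fun s => proxf (z s)) xv (fun s => M (a s)) hx
    (fun s hs => by
      have := M.hasFDerivAt.comp_hasDerivWithinAt s (hv s hs)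
      exact this.congr_of_mem (fun u hu => hxvM u hu) hs)
    (fun s hs => by
      have h := hode s hs
      rw [hγ, hβ, hγ] at h
      have e1 : proxf (z s + (1 - 3 / (s + 3)) • v s)
          = proxf (z s) + (1 - 3 / (s + 3)) • xv s := by
        rw [hpfM, hpfM, hxvM s hs, ← map_smul, ← map_add]
        congr 1
        abel
      rw [e1] at h
      rw [← hBap, ← hBap, hxvM s hs, hBM, hBM, ← hxvM s hs]
      exact h)
    t ht0
  have h0 := hHup xs (proxf (z 0))
  have hge := hGD (proxf (z t))
  have hFH : F (p (proxf (z t))) ≤ H (proxf (z t)) := by simp only [hH]; linarith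
  have ht3 : 0 < (t + 3) ^ 2 := by positivity
  rw [le_div_iff₀ ht3]
  set w0 := proxf (z 0) - xs with hw0
  have hn : ‖(2 : ℝ) • w0 + (3 : ℝ) • xv 0‖ ^ 2 ≤ 8 * ‖w0‖ ^ 2 + 18 * ‖xv 0‖ ^ 2 := by
    have h1 := norm_add_le ((2 : ℝ) • w0) ((3 : ℝ) • xv 0)
    rw [norm_smul, norm_smul] at h1
    norm_num at h1
    have h2 := norm_nonneg ((2 : ℝ) • w0 + (3 : ℝ) • xv 0)
    nlinarith [sq_nonneg (2 * ‖w0‖ - 3 * ‖xv 0‖)]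
  have k1 : α * ((F (p (proxf (z t))) - F xs) * (t + 3) ^ 2)
      ≤ α * (t + 3) ^ 2 * (H (proxf (z t)) - F xs) := by
    have : 0 ≤ α * (t + 3) ^ 2 * (H (proxf (z t)) - F (p (proxf (z t)))) :=
      mul_nonneg (by positivity) (by linarith)
    linarith
  have k2 : α * 9 * (H (proxf (z 0)) - F xs) ≤ α * 9 * (‖w0‖ ^ 2 / (2 * μ)) :=
    mul_le_mul_of_nonneg_left (by linarith) (by positivity)
  have k3 : α * ((9 / (2 * μ) + 9 / α) * (‖w0‖ ^ 2 + ‖xv 0‖ ^ 2))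
      = α * 9 * (‖w0‖ ^ 2 / (2 * μ)) + α * 9 * (‖xv 0‖ ^ 2 / (2 * μ))
        + 9 * (‖w0‖ ^ 2 + ‖xv 0‖ ^ 2) := by
    field_simp
  have k4 : 0 ≤ α * 9 * (‖xv 0‖ ^ 2 / (2 * μ)) := by positivity
  refine le_of_mul_le_mul_left ?_ hα
  rw [k3]
  have k5 := sq_nonneg ‖w0‖
  linarith
end
end

section
/- Let f(x) = (1/2)⟨x, Qx⟩ + ⟨q, x⟩ with Q symmetric positive definite with smallest eigenvalue m > 0 and largest eigenvalue L, let g : ℝⁿ → ℝ be convex and lower semicontinuous, and let μ ∈ (0, 1/L). Set m̃ = min{ (1 − μm)m/(1 + μm)², (1 − μL)L/(1 + μL)² }, and let α > 0 with α m̃ < 1, γ = 2√(α m̃)/(√(α m̃) + 1), β = 1 − γ, ρ = √(α m̃) − α m̃ / 2. Then there exists c₂ > 0, depending only on Q, q, g, μ, α, such that for every twice continuously differentiable z : [0,∞) → ℝⁿ satisfying z̈(t) + γ ż(t) + α G_μ(prox_{μf}(z(t) + β ż(t))) = 0 for all t ≥ 0, with x(t) := prox_{μf}(z(t)), and the unique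 minimizer x⋆ of F = f + g: ‖x(t) − x⋆‖² ≤ c₂ (‖x(0) − x⋆‖² + ‖ẋ(0)‖²) e^{−ρ t} for all t ≥ 0. -/
open Set RealInnerProductSpace

noncomputable section

section aux
variable {H : Type*} [NormedAddCommGroup H] [InnerProductSpace ℝ H]

theorem aux_min_var (g ψ : H → ℝ) (hg : ConvexOn ℝ univ g) (p e : H) (K : ℝ)
    (hψ : ∀ d, ψ (p + d) ≤ ψ p + ⟪e, d⟫ + K * ‖d‖ ^ 2)
    (hmin : ∀ w, g p + ψ p ≤ g w + ψ w) (w : H) :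
    - ⟪e, w - p⟫ ≤ g w - g p := by
  have key : ∀ t : ℝ, 0 < t → t ≤ 1 →
      - ⟪e, w - p⟫ - (g w - g p) ≤ t * (K * ‖w - p‖ ^ 2) := by
    intro t ht ht1
    have h1 := hmin (p + t • (w - p))
    have h2 := hψ (t • (w - p))
    have h3 := hg.2 (mem_univ p) (mem_univ w) (by linarith : (0:ℝ) ≤ 1 - t) ht.le (by ring)
    have h4 : (1 - t) • p + t • w = p + t • (w - p) := by module
    rw [h4] at h3
    rw [inner_smul_right, norm_smul, mul_pow, Real.norm_eq_abs, sq_abs] at h2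
    simp only [smul_eq_mul] at h3
    have : t * (- ⟪e, w - p⟫ - (g w - g p)) ≤ t * (t * (K * ‖w - p‖ ^ 2)) := by nlinarith
    exact le_of_mul_le_mul_left this ht
  by_contra hcon
  push Not at hcon
  set δ := - ⟪e, w - p⟫ - (g w - g p) with hδ
  set M := K * ‖w - p‖ ^ 2 with hM
  have hδ0 : 0 < δ := by linarith
  have h1 := key (min 1 (δ / (2 * (|M| + 1)))) (by positivity) (min_le_left _ _)
  have h2 : min 1 (δ / (2 * (|M| + 1))) * M ≤ (δ / (2 * (|M| + 1))) * (|M| + 1) := by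
    apply (mul_le_mul_of_nonneg_left (le_abs_self M) (by positivity)).trans
    apply mul_le_mul (min_le_right _ _) (by linarith) (by positivity) (by positivity)
  have h3 : (δ / (2 * (|M| + 1))) * (|M| + 1) = δ / 2 := by
    field_simp
  linarith

theorem aux_psd (A : H →L[ℝ] H) (hs : ∀ x y : H, ⟪A x, y⟫ = ⟪x, A y⟫)
    (M : ℝ) (hM : 0 < M) (h0 : ∀ x, 0 ≤ ⟪x, A x⟫) (h1 : ∀ x, ⟪x, A x⟫ ≤ M * ‖x‖ ^ 2) (x : H) :
    ‖A x‖ ^ 2 ≤ M * ⟪x, A x⟫ := by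
  have h2 := h0 (M • x - A x)
  have h3 := h1 (A x)
  have h4 : ⟪M • x - A x, A (M • x - A x)⟫
      = M ^ 2 * ⟪x, A x⟫ - 2 * M * ‖A x‖ ^ 2 + ⟪A x, A (A x)⟫ := by
    simp only [map_sub, map_smul, inner_sub_left, inner_sub_right, inner_smul_left,
      inner_smul_right, ← hs x, real_inner_self_eq_norm_sq]
    simp
    ring
  rw [h4] at h2
  have : M * ‖A x‖ ^ 2 ≤ M * (M * ⟪x, A x⟫) := by nlinarith
  exact le_of_mul_le_mul_left this hM

theorem aux_grad (h : H → ℝ) (x D : H) (K : ℝ)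
    (hl : ∀ y, h x + ⟪D, y - x⟫ ≤ h y)
    (hu : ∀ y, h y ≤ h x + ⟪D, y - x⟫ + K * ‖y - x‖ ^ 2) :
    HasFDerivAt h (innerSL ℝ D) x := by
  apply HasFDerivAt.of_isLittleO
  have : (fun y => h y - h x - (innerSL ℝ D) (y - x)) =O[nhds x] (fun y => ‖y - x‖ ^ 2) := by
    apply Asymptotics.IsBigO.of_bound K
    filter_upwards with y
    have h1 := hl y
    have h2 := hu y
    rw [Real.norm_eq_abs, Real.norm_eq_abs, abs_of_nonneg (sq_nonneg ‖y - x‖), innerSL_apply_apply,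
      abs_of_nonneg (by linarith)]
    linarith
  exact this.trans_isLittleO (Asymptotics.isLittleO_pow_sub_sub x (by norm_num))

theorem aux_alg (hx hy hs a1 a2 a3 A B N k b β γ ρ : ℝ) (hk : 0 < k) (hk1 : k < 1)
    (hβ : 0 < β) (hβ1 : β ≤ 1) (hb : b * β = 1) (hρ : ρ = k - k ^ 2 / 2)
    (hγ : γ + β * k ^ 2 = 2 * ρ) (hA : 0 ≤ A) (hN : 0 ≤ N)
    (h1 : hy - β * a2 + k ^ 2 / 2 * (β ^ 2 * A) ≤ hx)
    (h2 : hx + β * a1 + k ^ 2 / 2 * (β ^ 2 * A) ≤ hy)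
    (h3 : hy - (a3 + β * a2) + k ^ 2 / 2 * (N + 2 * β * B + β ^ 2 * A) ≤ hs) :
    a1 - a2 - ρ * a3 + (ρ - γ) * (ρ * B + A) + ρ * (hx - hs)
      + ρ / 2 * (ρ ^ 2 * N + 2 * ρ * B + A) ≤ 0 := by
  have hρ0 : 0 < ρ := by rw [hρ]; nlinarith
  have hρk : ρ ≤ k := by rw [hρ]; nlinarith
  have hb1 : 1 ≤ b := by nlinarith
  have e1 := mul_le_mul_of_nonneg_left h1 (by linarith : 0 ≤ b - ρ)
  have e2 := mul_le_mul_of_nonneg_left h2 (by linarith : 0 ≤ b)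
  have e3 := mul_le_mul_of_nonneg_left h3 hρ0.le
  have f1 : b * (β * a1) = a1 := by rw [← mul_assoc, hb, one_mul]
  have f2 : b * (β * a2) = a2 := by rw [← mul_assoc, hb, one_mul]
  have f3 : b * (k ^ 2 / 2 * (β ^ 2 * A)) = k ^ 2 / 2 * (β * A) := by
    linear_combination (k ^ 2 / 2 * β * A) * hb
  have n1 : 0 ≤ ρ * A := by positivity
  have n2 : 0 ≤ ρ * N * (k ^ 2 - ρ ^ 2) := by
    apply mul_nonneg (by positivity); nlinarith
  have g1 : γ = 2 * ρ - β * k ^ 2 := by linarith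
  subst g1
  nlinarith

theorem aux_lyap (S : H →L[ℝ] H) (hS : ∀ x y : H, ⟪S x, y⟫ = ⟪x, S y⟫) (h : H → ℝ) (D : H → H)
    (xs : H) (k K s0 s1 γ β ρ : ℝ) (hk : 0 < k) (hk1 : k < 1) (hK : 0 ≤ K)
    (hs0 : 0 < s0) (hSl : ∀ x, s0 * ‖x‖ ^ 2 ≤ ⟪x, S x⟫) (hs1 : 0 ≤ s1)
    (hSu : ∀ x, ⟪x, S x⟫ ≤ s1 * ‖x‖ ^ 2)
    (hl : ∀ x y, h x + ⟪D x, y - x⟫ + k ^ 2 / 2 * ⟪y - x, S (y - x)⟫ ≤ h y)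
    (hu : ∀ x y, h y ≤ h x + ⟪D x, y - x⟫ + K * ‖y - x‖ ^ 2)
    (hDs : D xs = 0) (hβ : 0 < β) (hβ1 : β ≤ 1) (hρ : ρ = k - k ^ 2 / 2)
    (hγ : γ + β * k ^ 2 = 2 * ρ) (x v a : ℝ → H)
    (hx : ∀ t ∈ Ici (0 : ℝ), HasDerivWithinAt x (v t) (Ici 0) t)
    (hv : ∀ t ∈ Ici (0 : ℝ), HasDerivWithinAt v (a t) (Ici 0) t)
    (hode : ∀ t ∈ Ici (0 : ℝ), S (a t) + γ • S (v t) + D (x t + β • v t) = 0) :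
    ∀ t ∈ Ici (0 : ℝ), ‖x t - xs‖ ^ 2 ≤
      (2 / (k ^ 2 * s0) * (K + s1 * (1 + ρ ^ 2))) * (‖x 0 - xs‖ ^ 2 + ‖v 0‖ ^ 2)
        * Real.exp (-ρ * t) := by
  have hSnn : ∀ x, 0 ≤ ⟪x, S x⟫ := fun x => le_trans (by positivity) (hSl x)
  have hgrad : ∀ x, HasFDerivAt h (innerSL ℝ (D x)) x := fun x =>
    aux_grad h x (D x) K (fun y => by
      have := hl x y
      have := mul_nonneg (by positivity : 0 ≤ k ^ 2 / 2) (hSnn (y - x))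
      linarith) (hu x)
  set w : ℝ → H := fun t => ρ • (x t - xs) + v t with hw
  set V : ℝ → ℝ := fun t => h (x t) - h xs + (1 / 2) * ⟪w t, S (w t)⟫ with hV
  have hVd : ∀ t ∈ Ici (0 : ℝ), HasDerivWithinAt V
      (⟪D (x t), v t⟫ + ⟪w t, S (ρ • v t + a t)⟫) (Ici 0) t := by
    intro t ht
    have d1 : HasDerivWithinAt (fun s => h (x s)) (⟪D (x t), v t⟫) (Ici 0) t := by
      have := (hgrad (x t)).comp_hasDerivWithinAt t (hx t ht)
      exact this.congr_deriv (by simp)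
    have d2 : HasDerivWithinAt w (ρ • v t + a t) (Ici 0) t :=
      (((hx t ht).sub_const xs).const_smul ρ).add (hv t ht)
    have d3 : HasDerivWithinAt (fun s => S (w s)) (S (ρ • v t + a t)) (Ici 0) t :=
      S.hasFDerivAt.comp_hasDerivWithinAt t d2
    have d4 := d2.inner ℝ d3
    have d5 := (d1.sub_const (h xs)).add (d4.const_mul (1 / 2))
    refine d5.congr_deriv ?_
    have : ⟪ρ • v t + a t, S (w t)⟫ = ⟪w t, S (ρ • v t + a t)⟫ := by
      rw [← hS, real_inner_comm]
    rw [this]; ring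
  have hVle : ∀ t ∈ Ici (0 : ℝ),
      ⟪D (x t), v t⟫ + ⟪w t, S (ρ • v t + a t)⟫ + ρ * V t ≤ 0 := by
    intro t ht
    have ea : S (a t) = -(γ • S (v t)) - D (x t + β • v t) := by
      rw [← sub_eq_zero, ← hode t ht]; abel
    have l1 := hl (x t + β • v t) (x t)
    have l2 := hl (x t) (x t + β • v t)
    have l3 := hl (x t + β • v t) xs
    set y := x t + β • v t with hy
    have y1 : x t - y = -(β • v t) := by rw [hy]; abel
    have y2 : y - x t = β • v t := by rw [hy]; abel
    have y3 : xs - y = -((x t - xs) + β • v t) := by rw [hy]; abel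
    rw [y1] at l1
    rw [y2] at l2
    rw [y3] at l3
    set d := x t - xs with hd
    have hsym : ⟪v t, S d⟫ = ⟪d, S (v t)⟫ := by rw [← hS, real_inner_comm]
    have hwt : w t = ρ • d + v t := rfl
    have hVt : V t = h (x t) - h xs + (1 / 2) * ⟪w t, S (w t)⟫ := rfl
    rw [hVt, hwt, map_add, ea]
    simp only [map_neg, map_add, map_smul, inner_neg_left, inner_neg_right, inner_add_left,
      inner_add_right, inner_sub_right, real_inner_smul_left, real_inner_smul_right, hsym] at l1 l2 l3 ⊢
    have := aux_alg (h (x t)) (h y) (h xs) ⟪D (x t), v t⟫ ⟪D y, v t⟫ ⟪D y, d⟫ ⟪v t, S (v t)⟫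
      ⟪d, S (v t)⟫ ⟪d, S d⟫ k β⁻¹ β γ ρ hk hk1 hβ hβ1 (by field_simp) hρ hγ (hSnn _) (hSnn _)
      (by linarith) (by linarith) (by linarith)
    rw [real_inner_comm (D y) d, real_inner_comm (D y) (v t)]
    linarith
  have hanti : AntitoneOn (fun t => Real.exp (ρ * t) * V t) (Ici 0) := by
    have hd : ∀ t ∈ Ici (0 : ℝ), HasDerivWithinAt (fun t => Real.exp (ρ * t) * V t)
        (Real.exp (ρ * t) * (⟪D (x t), v t⟫ + ⟪w t, S (ρ • v t + a t)⟫ + ρ * V t)) (Ici 0) t := by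
      intro t ht
      have e1 : HasDerivWithinAt (fun t => Real.exp (ρ * t)) (Real.exp (ρ * t) * (ρ * 1)) (Ici 0) t :=
        ((hasDerivAt_id t).const_mul ρ).exp.hasDerivWithinAt
      refine (e1.mul (hVd t ht)).congr_deriv ?_
      ring
    apply antitoneOn_of_hasDerivWithinAt_nonpos (convex_Ici 0)
      (fun t ht => (hd t ht).continuousWithinAt)
      (fun t ht => (hd t (interior_subset ht)).mono interior_subset)
    intro t ht
    exact mul_nonpos_of_nonneg_of_nonpos (Real.exp_pos _).le (hVle t (interior_subset ht))
  intro t ht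
  have h1 := hanti (mem_Ici.2 le_rfl) ht ht
  simp only [mul_zero, Real.exp_zero, one_mul] at h1
  have h2 : k ^ 2 / 2 * (s0 * ‖x t - xs‖ ^ 2) ≤ V t := by
    have a1 := hl xs (x t)
    rw [hDs, inner_zero_left] at a1
    have a2 := mul_le_mul_of_nonneg_left (hSl (x t - xs)) (by positivity : 0 ≤ k ^ 2 / 2)
    have a3 := hSnn (w t)
    simp only [hV]; linarith
  have h3 : V 0 ≤ (K + s1 * (1 + ρ ^ 2)) * (‖x 0 - xs‖ ^ 2 + ‖v 0‖ ^ 2) := by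
    have a1 := hu xs (x 0)
    rw [hDs, inner_zero_left] at a1
    have a2 := hSu (w 0)
    have a3 : ‖w 0‖ ^ 2 ≤ 2 * (1 + ρ ^ 2) * (‖x 0 - xs‖ ^ 2 + ‖v 0‖ ^ 2) := by
      have b1 : ‖w 0‖ ≤ |ρ| * ‖x 0 - xs‖ + ‖v 0‖ := by
        refine (norm_add_le _ _).trans ?_
        rw [norm_smul, Real.norm_eq_abs]
      have b2 : ‖w 0‖ ^ 2 ≤ (|ρ| * ‖x 0 - xs‖ + ‖v 0‖) ^ 2 :=
        pow_le_pow_left₀ (norm_nonneg _) b1 2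
      have b3 := sq_abs ρ
      nlinarith [sq_nonneg (|ρ| * ‖x 0 - xs‖ - ‖v 0‖), sq_nonneg (ρ * ‖v 0‖), sq_nonneg (‖x 0 - xs‖)]
    have a4 := mul_le_mul_of_nonneg_left a3 hs1
    have a5 := mul_nonneg hK (sq_nonneg ‖v 0‖)
    simp only [hV]; linarith
  have h4 : V t ≤ Real.exp (-ρ * t) * V 0 := by
    have : V t = Real.exp (-ρ * t) * (Real.exp (ρ * t) * V t) := by
      rw [← mul_assoc, ← Real.exp_add]; simp
    rw [this]
    exact mul_le_mul_of_nonneg_left h1 (Real.exp_pos _).le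
  have h5 := mul_le_mul_of_nonneg_left h3 (Real.exp_pos (-ρ * t)).le
  have h6 : ‖x t - xs‖ ^ 2 = 2 / (k ^ 2 * s0) * (k ^ 2 / 2 * (s0 * ‖x t - xs‖ ^ 2)) := by
    field_simp
  rw [h6]
  have h7 := mul_le_mul_of_nonneg_left ((h2.trans h4).trans h5)
    (by positivity : 0 ≤ 2 / (k ^ 2 * s0))
  refine h7.trans (le_of_eq ?_)
  ring

theorem aux_moreau (g : H → ℝ) (hg : ConvexOn ℝ univ g) (μ : ℝ) (hμ : 0 < μ) (pr : H → H)
    (hpr : ∀ v, IsMinOn (fun z => g z + ‖z - v‖ ^ 2 / (2 * μ)) univ (pr v)) (u w : H) :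
    ⟪μ⁻¹ • (u - pr u), w - pr u⟫ ≤ g w - g (pr u) := by
  have := aux_min_var g (fun z => ‖z - u‖ ^ 2 / (2 * μ)) hg (pr u) (μ⁻¹ • (pr u - u)) (1 / (2 * μ))
    (fun d => by
      have : pr u + d - u = (pr u - u) + d := by abel
      simp only [this, norm_add_sq_real, real_inner_smul_left]
      apply le_of_eq
      field_simp)
    (fun w => by simpa using hpr u (mem_univ w)) w
  rw [← inner_neg_left, ← smul_neg, neg_sub] at this
  exact this

theorem aux_moreau_lower (g : H → ℝ) (hg : ConvexOn ℝ univ g) (μ : ℝ) (hμ : 0 < μ) (pr : H → H)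
    (hpr : ∀ v, IsMinOn (fun z => g z + ‖z - v‖ ^ 2 / (2 * μ)) univ (pr v)) (u w : H) :
    g (pr u) + ‖pr u - u‖ ^ 2 / (2 * μ) + ⟪μ⁻¹ • (u - pr u), w - u⟫
      ≤ g (pr w) + ‖pr w - w‖ ^ 2 / (2 * μ) := by
  have h1 := aux_moreau g hg μ hμ pr hpr u (pr w)
  have e1 : pr w - pr u = (w - u) + ((pr w - w) - (pr u - u)) := by abel
  set r := pr u - u
  set r' := pr w - w
  have e2 : u - pr u = - r := by simp [r]
  rw [e1, e2] at h1
  rw [e2]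
  simp only [smul_neg, inner_neg_left, inner_add_right, inner_sub_right, real_inner_smul_left,
    real_inner_self_eq_norm_sq] at h1 ⊢
  have h2 : 0 ≤ ‖r' - r‖ ^ 2 / (2 * μ) := by positivity
  rw [norm_sub_sq_real, real_inner_comm] at h2
  have h3 : (‖r'‖ ^ 2 - 2 * ⟪r, r'⟫ + ‖r‖ ^ 2) / (2 * μ)
    = ‖r'‖ ^ 2 / (2 * μ) - μ⁻¹ * ⟪r, r'⟫ + μ⁻¹ * ‖r‖ ^ 2 - ‖r‖ ^ 2 / (2 * μ) := by
    field_simp; ring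
  rw [h3] at h2
  linarith

theorem aux_moreau_upper (g : H → ℝ) (μ : ℝ) (hμ : 0 < μ) (pr : H → H)
    (hpr : ∀ v, IsMinOn (fun z => g z + ‖z - v‖ ^ 2 / (2 * μ)) univ (pr v)) (u w : H) :
    g (pr w) + ‖pr w - w‖ ^ 2 / (2 * μ) ≤
    g (pr u) + ‖pr u - u‖ ^ 2 / (2 * μ) + ⟪μ⁻¹ • (u - pr u), w - u⟫ + ‖w - u‖ ^ 2 / (2 * μ) := by
  have h1 : g (pr w) + ‖pr w - w‖ ^ 2 / (2 * μ) ≤ g (pr u) + ‖pr u - w‖ ^ 2 / (2 * μ) :=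
    hpr w (mem_univ (pr u))
  have e1 : pr u - w = (pr u - u) - (w - u) := by abel
  have e2 : u - pr u = - (pr u - u) := by abel
  rw [e1, norm_sub_sq_real (pr u - u)] at h1
  rw [e2, smul_neg, inner_neg_left, real_inner_smul_left]
  refine h1.trans (le_of_eq ?_)
  field_simp
  ring

theorem aux_quad (Q : H →L[ℝ] H) (hQ : ∀ x y : H, ⟪Q x, y⟫ = ⟪x, Q y⟫) (q x d : H) :
    (1 / 2) * ⟪x + d, Q (x + d)⟫ + ⟪q, x + d⟫
      = (1 / 2) * ⟪x, Q x⟫ + ⟪q, x⟫ + ⟪Q x + q, d⟫ + (1 / 2) * ⟪d, Q d⟫ := by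
  have : ⟪d, Q x⟫ = ⟪x, Q d⟫ := by rw [← hQ, real_inner_comm]
  simp only [map_add, inner_add_left, inner_add_right, this, hQ]
  ring

/-- forward-backward envelope -/
def auxE (Q : H →L[ℝ] H) (q : H) (g : H → ℝ) (μ : ℝ) (pr : H → H) (x : H) : ℝ :=
  (1 / 2) * ⟪x, Q x⟫ + ⟪q, x⟫ - μ / 2 * ‖Q x + q‖ ^ 2
    + (g (pr (x - μ • (Q x + q))) +
      ‖pr (x - μ • (Q x + q)) - (x - μ • (Q x + q))‖ ^ 2 / (2 * μ))

theorem aux_env (Q : H →L[ℝ] H) (hQ : ∀ x y : H, ⟪Q x, y⟫ = ⟪x, Q y⟫) (q : H) (g : H → ℝ)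
    (hg : ConvexOn ℝ univ g) (μ : ℝ) (hμ : 0 < μ) (pr : H → H)
    (hpr : ∀ v, IsMinOn (fun z => g z + ‖z - v‖ ^ 2 / (2 * μ)) univ (pr v)) (x y : H) (G : H)
    (hG : G = μ⁻¹ • (x - pr (x - μ • (Q x + q)))) :
    auxE Q q g μ pr x + ⟪G, (y - x) - μ • Q (y - x)⟫
        + (1 / 2) * (⟪y - x, Q (y - x)⟫ - μ * ‖Q (y - x)‖ ^ 2) ≤ auxE Q q g μ pr y ∧
    auxE Q q g μ pr y ≤ auxE Q q g μ pr x + ⟪G, (y - x) - μ • Q (y - x)⟫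
        + (1 / 2) * (⟪y - x, Q (y - x)⟫ - μ * ‖Q (y - x)‖ ^ 2)
        + ‖(y - x) - μ • Q (y - x)‖ ^ 2 / (2 * μ) := by
  obtain ⟨d, rfl⟩ : ∃ d, y = x + d := ⟨y - x, by abel⟩
  have hl := aux_moreau_lower g hg μ hμ pr hpr (x - μ • (Q x + q)) (x + d - μ • (Q (x + d) + q))
  have hu := aux_moreau_upper g μ hμ pr hpr (x - μ • (Q x + q)) (x + d - μ • (Q (x + d) + q))
  have e1 : x + d - μ • (Q (x + d) + q) - (x - μ • (Q x + q)) = d - μ • Q d := by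
    rw [map_add]; module
  have e2 : μ⁻¹ • (x - μ • (Q x + q) - pr (x - μ • (Q x + q))) = G - (Q x + q) := by
    rw [hG]
    have : μ⁻¹ • μ • (Q x + q) = Q x + q := by rw [smul_smul, inv_mul_cancel₀ hμ.ne', one_smul]
    simp only [smul_sub, this]
    abel
  rw [e1, e2] at hl hu
  have e3 : x + d - x = d := by abel
  rw [e3]
  unfold auxE
  have e4 : ‖Q (x + d) + q‖ ^ 2 = ‖Q x + q‖ ^ 2 + 2 * ⟪Q x + q, Q d⟫ + ‖Q d‖ ^ 2 := by
    rw [← norm_add_sq_real, map_add]; congr 2; abel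
  rw [aux_quad Q hQ, e4]
  have e5 : ⟪G - (Q x + q), d - μ • Q d⟫ = ⟪G, d - μ • Q d⟫ - ⟪Q x + q, d⟫
      + μ * ⟪Q x + q, Q d⟫ := by
    simp only [inner_sub_left, inner_sub_right, real_inner_smul_right]; ring
  rw [e5] at hl hu
  constructor <;> linarith

theorem aux_fix (Q : H →L[ℝ] H) (hQ : ∀ x y : H, ⟪Q x, y⟫ = ⟪x, Q y⟫) (q : H) (g : H → ℝ)
    (L : ℝ) (hQL : ∀ x, ⟪x, Q x⟫ ≤ L * ‖x‖ ^ 2)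
    (hg : ConvexOn ℝ univ g) (μ : ℝ) (hμ : 0 < μ) (pr : H → H)
    (hpr : ∀ v, IsMinOn (fun z => g z + ‖z - v‖ ^ 2 / (2 * μ)) univ (pr v)) (xs : H)
    (hxs : ∀ w, g xs + ((1 / 2) * ⟪xs, Q xs⟫ + ⟪q, xs⟫) ≤ g w + ((1 / 2) * ⟪w, Q w⟫ + ⟪q, w⟫)) :
    pr (xs - μ • (Q xs + q)) = xs := by
  have h1 := aux_moreau g hg μ hμ pr hpr (xs - μ • (Q xs + q)) xs
  set p := pr (xs - μ • (Q xs + q)) with hp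
  have h2 := aux_min_var g (fun w => (1 / 2) * ⟪w, Q w⟫ + ⟪q, w⟫) hg xs (Q xs + q) (L / 2)
    (fun d => by
      simp only [aux_quad Q hQ]
      have := hQL d
      linarith) hxs p
  have e1 : xs - μ • (Q xs + q) - p = (xs - p) - μ • (Q xs + q) := by abel
  have e2 : p - xs = -(xs - p) := by abel
  rw [e1, smul_sub, smul_smul, inv_mul_cancel₀ hμ.ne', one_smul, inner_sub_left,
    real_inner_smul_left, real_inner_self_eq_norm_sq] at h1
  rw [e2, inner_neg_right] at h2
  have h3 : μ⁻¹ * ‖xs - p‖ ^ 2 ≤ 0 := by linarith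
  have h4 : ‖xs - p‖ ^ 2 ≤ 0 := by
    by_contra hc
    push Not at hc
    have := mul_pos (inv_pos.2 hμ) hc
    linarith
  have h5 : ‖xs - p‖ = 0 := by nlinarith [norm_nonneg (xs - p), sq_nonneg ‖xs - p‖]
  rw [norm_eq_zero, sub_eq_zero] at h5
  exact h5.symm

theorem aux_proxf (Q : H →L[ℝ] H) (hQ : ∀ x y : H, ⟪Q x, y⟫ = ⟪x, Q y⟫) (q : H)
    (L : ℝ) (hQL : ∀ x, ⟪x, Q x⟫ ≤ L * ‖x‖ ^ 2) (μ : ℝ) (hμ : 0 < μ) (p v : H)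
    (hp : ∀ w, ((1 / 2) * ⟪p, Q p⟫ + ⟪q, p⟫) + ‖p - v‖ ^ 2 / (2 * μ)
      ≤ ((1 / 2) * ⟪w, Q w⟫ + ⟪q, w⟫) + ‖w - v‖ ^ 2 / (2 * μ)) :
    p + μ • Q p = v - μ • q := by
  set e := Q p + q + μ⁻¹ • (p - v) with he
  have h2 := aux_min_var (fun _ => (0 : ℝ))
    (fun w => ((1 / 2) * ⟪w, Q w⟫ + ⟪q, w⟫) + ‖w - v‖ ^ 2 / (2 * μ))
    (convexOn_const 0 convex_univ) p e (L / 2 + 1 / (2 * μ))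
    (fun d => by
      have e1 : p + d - v = (p - v) + d := by abel
      simp only [aux_quad Q hQ]
      simp only [e1, norm_add_sq_real, he, inner_add_left, real_inner_smul_left]
      have h1 := hQL d
      have h2 : (‖p - v‖ ^ 2 + 2 * ⟪p - v, d⟫ + ‖d‖ ^ 2) / (2 * μ) =
        ‖p - v‖ ^ 2 / (2 * μ) + μ⁻¹ * ⟪p - v, d⟫ + 1 / (2 * μ) * ‖d‖ ^ 2 := by
        field_simp
      rw [h2]
      linarith) (fun w => by simpa using hp w) (p - e)
  have e2 : p - e - p = - e := by abel
  rw [e2, inner_neg_right, real_inner_self_eq_norm_sq] at h2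
  have h5 : ‖e‖ = 0 := by nlinarith [norm_nonneg e, sq_nonneg ‖e‖]
  rw [norm_eq_zero] at h5
  have h6 : μ • e = 0 := by rw [h5, smul_zero]
  rw [he, smul_add, smul_smul, mul_inv_cancel₀ hμ.ne', one_smul] at h6
  rw [← sub_eq_zero, ← h6]
  module

theorem aux_spec (X Y Z m μ mt : ℝ) (hm : 0 < m) (hμ : 0 < μ) (hμm : μ * m < 1)
    (hmt : mt ≤ (1 - μ * m) * m / (1 + μ * m) ^ 2) (hmt0 : 0 < mt)
    (h1 : Z - 2 * m * Y + m ^ 2 * X ≤ (1 / μ - m) * (Y - m * X)) (h2 : μ * Y ≤ X) :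
    mt * (X - μ ^ 2 * Z) ≤ Y - μ * Z := by
  have hp : 0 < μ * m := by positivity
  have a1 : mt * (1 + μ * m) ≤ m := by
    rw [le_div_iff₀ (by positivity)] at hmt
    have : mt * (1 + μ * m) * (1 + μ * m) ≤ m * (1 + μ * m) := by nlinarith
    exact le_of_mul_le_mul_right this (by positivity)
  have a2 : μ * (Z - 2 * m * Y + m ^ 2 * X) ≤ (1 - μ * m) * (Y - m * X) := by
    have := mul_le_mul_of_nonneg_left h1 hμ.le
    have e : μ * ((1 / μ - m) * (Y - m * X)) = (1 - μ * m) * (Y - m * X) := by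
      field_simp
    linarith
  have a3 : m * (X - μ * Y) ≤ Y - μ * Z := by linarith
  have a4 : 0 ≤ 1 - μ * mt := by nlinarith
  have a5 := mul_le_mul_of_nonneg_left a3 a4
  have a6 : 0 ≤ (m - mt * (1 + μ * m)) * (X - μ * Y) := mul_nonneg (by linarith) (by linarith)
  linarith

end aux

/-- Theorem 2, Douglas–Rachford case: accelerated exponential
convergence of the accelerated Douglas–Rachford splitting dynamics for a
strongly convex quadratic `f` plus a convex lower semicontinuous `g`. -/
theorem accelerated_DR_strongly_convex_quadratic {n : ℕ}
    (Q : EuclideanSpace ℝ (Fin n) →L[ℝ] EuclideanSpace ℝ (Fin n))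
    (q : EuclideanSpace ℝ (Fin n)) (g : EuclideanSpace ℝ (Fin n) → ℝ)
    (m L μ α mt γ β ρ : ℝ)
    (hQsym : ∀ x y : EuclideanSpace ℝ (Fin n), ⟪Q x, y⟫ = ⟪x, Q y⟫)
    (hm : 0 < m)
    (hQm : ∀ x : EuclideanSpace ℝ (Fin n), m * ‖x‖ ^ 2 ≤ ⟪x, Q x⟫)
    (hQmmin : ∃ x : EuclideanSpace ℝ (Fin n), x ≠ 0 ∧ ⟪x, Q x⟫ = m * ‖x‖ ^ 2)
    (hQL : ∀ x : EuclideanSpace ℝ (Fin n), ⟪x, Q x⟫ ≤ L * ‖x‖ ^ 2)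
    (hQLmax : ∃ x : EuclideanSpace ℝ (Fin n), x ≠ 0 ∧ ⟪x, Q x⟫ = L * ‖x‖ ^ 2)
    (f F : EuclideanSpace ℝ (Fin n) → ℝ)
    (hf : ∀ x, f x = (1 / 2) * ⟪x, Q x⟫ + ⟪q, x⟫)
    (hF : ∀ x, F x = f x + g x)
    (hgconv : ConvexOn ℝ univ g) (hglsc : LowerSemicontinuous g)
    (hμ : μ ∈ Ioo 0 (1 / L))
    (hmt : mt = min ((1 - μ * m) * m / (1 + μ * m) ^ 2)
                    ((1 - μ * L) * L / (1 + μ * L) ^ 2))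
    (hα : 0 < α) (hαmt : α * mt < 1)
    (hγ : γ = 2 * Real.sqrt (α * mt) / (Real.sqrt (α * mt) + 1))
    (hβ : β = 1 - γ)
    (hρ : ρ = Real.sqrt (α * mt) - α * mt / 2)
    (proxg proxf : EuclideanSpace ℝ (Fin n) → EuclideanSpace ℝ (Fin n))
    (hproxg : ∀ v, IsMinOn (fun z => g z + ‖z - v‖ ^ 2 / (2 * μ)) univ (proxg v))
    (hproxf : ∀ v, IsMinOn (fun z => f z + ‖z - v‖ ^ 2 / (2 * μ)) univ (proxf v))
    (G : EuclideanSpace ℝ (Fin n) → EuclideanSpace ℝ (Fin n))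
    (hG : ∀ x, G x = μ⁻¹ • (x - proxg (x - μ • gradient f x))) :
    ∃ c > (0 : ℝ), ∀ z v a xv : ℝ → EuclideanSpace ℝ (Fin n),
      (∀ t ∈ Ici (0 : ℝ), HasDerivWithinAt z (v t) (Ici 0) t) →
      (∀ t ∈ Ici (0 : ℝ), HasDerivWithinAt v (a t) (Ici 0) t) →
      ContinuousOn a (Ici 0) →
      (∀ t ∈ Ici (0 : ℝ), a t + γ • v t + α • G (proxf (z t + β • v t)) = 0) →
      (∀ t ∈ Ici (0 : ℝ), HasDerivWithinAt (fun s => proxf (z s)) (xv t) (Ici 0) t) →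
      ∀ xs, IsMinOn F univ xs →
        ∀ t ∈ Ici (0 : ℝ),
          ‖proxf (z t) - xs‖ ^ 2 ≤
            c * (‖proxf (z 0) - xs‖ ^ 2 + ‖xv 0‖ ^ 2) * Real.exp (-ρ * t) := by
  have hμ0 : 0 < μ := hμ.1
  have hL : 0 < L := by
    by_contra hc
    have : 1 / L ≤ 0 := one_div_nonpos.2 (not_lt.1 hc)
    linarith [hμ.1, hμ.2]
  have hμL : μ * L < 1 := by
    have := hμ.2
    rwa [lt_div_iff₀ hL] at this
  have hmL : m ≤ L := by
    obtain ⟨x, hx, hx'⟩ := hQmmin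
    have := hQL x
    rw [hx'] at this
    exact le_of_mul_le_mul_right this (by positivity)
  have hμm : μ * m < 1 := lt_of_le_of_lt (mul_le_mul_of_nonneg_left hmL hμ0.le) hμL
  have hmt0 : 0 < mt := by
    rw [hmt]
    apply lt_min
    · exact div_pos (mul_pos (by linarith) hm) (by positivity)
    · exact div_pos (mul_pos (by linarith) hL) (by positivity)
  have hmt1 : mt ≤ (1 - μ * m) * m / (1 + μ * m) ^ 2 := hmt ▸ min_le_left _ _
  set k := Real.sqrt (α * mt) with hkdef
  have hk2 : k ^ 2 = α * mt := Real.sq_sqrt (by positivity)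
  have hk0 : 0 < k := Real.sqrt_pos.2 (by positivity)
  have hk1 : k < 1 := by nlinarith
  have hρ' : ρ = k - k ^ 2 / 2 := by rw [hρ, hk2]
  have hβ' : β = (1 - k) / (k + 1) := by rw [hβ, hγ]; field_simp; ring
  have hβ0 : 0 < β := by rw [hβ']; exact div_pos (by linarith) (by linarith)
  have hβ1 : β ≤ 1 := by rw [hβ', div_le_one (by linarith)]; linarith
  have hγβ : γ + β * k ^ 2 = 2 * ρ := by rw [hρ', hβ', hγ]; field_simp; ring
  have hQnn : ∀ x : EuclideanSpace ℝ (Fin n), 0 ≤ ⟪x, Q x⟫ := fun x =>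
    le_trans (by positivity) (hQm x)
  have hQsq : ∀ x, ‖Q x‖ ^ 2 ≤ L * ⟪x, Q x⟫ := aux_psd Q hQsym L hL hQnn hQL
  have hgrad : ∀ x, gradient f x = Q x + q := by
    intro x
    have hfd : HasGradientAt f (Q x + q) x := by
      rw [hasGradientAt_iff_hasFDerivAt]
      apply aux_grad f x (Q x + q) (L / 2)
      · intro y
        have := aux_quad Q hQsym q x (y - x)
        rw [add_sub_cancel] at this
        rw [hf, hf, this]
        linarith [hQnn (y - x)]
      · intro y
        have := aux_quad Q hQsym q x (y - x)
        rw [add_sub_cancel] at this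
        rw [hf, hf, this]
        linarith [hQL (y - x)]
    exact hfd.gradient
  have hG' : ∀ x, G x = μ⁻¹ • (x - proxg (x - μ • (Q x + q))) := fun x => by rw [hG, hgrad]
  set C : EuclideanSpace ℝ (Fin n) →L[ℝ] EuclideanSpace ℝ (Fin n) :=
    ContinuousLinearMap.id ℝ _ - μ • Q with hC
  set B : EuclideanSpace ℝ (Fin n) →L[ℝ] EuclideanSpace ℝ (Fin n) :=
    ContinuousLinearMap.id ℝ _ + μ • Q with hB
  have hCx : ∀ x, C x = x - μ • Q x := fun x => by simp [hC]
  have hBx : ∀ x, B x = x + μ • Q x := fun x => by simp [hB]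
  have hCsym : ∀ x y, ⟪C x, y⟫ = ⟪x, C y⟫ := fun x y => by
    simp only [hCx, inner_sub_left, inner_sub_right, real_inner_smul_left, real_inner_smul_right,
      hQsym]
  set S := C.comp B with hSdef
  have hSx : ∀ x, S x = x - (μ ^ 2) • Q (Q x) := fun x => by
    simp only [hSdef, ContinuousLinearMap.comp_apply, hCx, hBx, map_add, map_smul]
    module
  have hSsym : ∀ x y, ⟪S x, y⟫ = ⟪x, S y⟫ := fun x y => by
    simp only [hSx, inner_sub_left, inner_sub_right, real_inner_smul_left, real_inner_smul_right,
      hQsym]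
  have hSform : ∀ x, ⟪x, S x⟫ = ‖x‖ ^ 2 - μ ^ 2 * ‖Q x‖ ^ 2 := fun x => by
    rw [hSx, inner_sub_right, real_inner_smul_right, ← hQsym, real_inner_self_eq_norm_sq,
      real_inner_self_eq_norm_sq]
  have hSl : ∀ x, (1 - (μ * L) ^ 2) * ‖x‖ ^ 2 ≤ ⟪x, S x⟫ := fun x => by
    rw [hSform]
    have h1 : ‖Q x‖ ^ 2 ≤ L * (L * ‖x‖ ^ 2) :=
      (hQsq x).trans (mul_le_mul_of_nonneg_left (hQL x) hL.le)
    have h2 := mul_le_mul_of_nonneg_left h1 (sq_nonneg μ)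
    linarith
  have hSu : ∀ x, ⟪x, S x⟫ ≤ 1 * ‖x‖ ^ 2 := fun x => by
    rw [hSform]
    have : 0 ≤ μ ^ 2 * ‖Q x‖ ^ 2 := by positivity
    linarith
  have hs0 : 0 < 1 - (μ * L) ^ 2 := by
    have : 0 < μ * L := by positivity
    nlinarith
  have hspec : ∀ d, mt * ⟪d, S d⟫ ≤ ⟪d, Q d⟫ - μ * ‖Q d‖ ^ 2 := by
    intro d
    rw [hSform]
    have hM : 0 < 1 / μ - m := by
      rw [sub_pos, lt_div_iff₀ hμ0]; linarith
    have hμL' : L ≤ 1 / μ := by rw [le_div_iff₀ hμ0]; linarith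
    have hA : ∀ x : EuclideanSpace ℝ (Fin n),
        (Q - m • ContinuousLinearMap.id ℝ (EuclideanSpace ℝ (Fin n))) x = Q x - m • x :=
      fun x => by simp
    have hAf : ∀ x : EuclideanSpace ℝ (Fin n), ⟪x, Q x - m • x⟫ = ⟪x, Q x⟫ - m * ‖x‖ ^ 2 :=
      fun x => by rw [inner_sub_right, real_inner_smul_right, real_inner_self_eq_norm_sq]
    have h1 := aux_psd (Q - m • ContinuousLinearMap.id ℝ _)
      (fun x y => by
        simp only [hA, inner_sub_left, inner_sub_right, real_inner_smul_left,
          real_inner_smul_right, hQsym])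
      (1 / μ - m) hM
      (fun x => by rw [hA, hAf]; linarith [hQm x])
      (fun x => by
        rw [hA, hAf]
        have := mul_le_mul_of_nonneg_right hμL' (sq_nonneg ‖x‖)
        linarith [hQL x]) d
    rw [hA, hAf, norm_sub_sq_real, real_inner_smul_right, norm_smul, mul_pow, Real.norm_eq_abs,
      sq_abs, real_inner_comm] at h1
    refine aux_spec (‖d‖ ^ 2) ⟪d, Q d⟫ (‖Q d‖ ^ 2) m μ mt hm hμ0 hμm hmt1 hmt0 (by linarith) ?_
    have a1 := mul_le_mul_of_nonneg_left (hQL d) hμ0.le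
    have a2 := mul_le_mul_of_nonneg_right hμL.le (sq_nonneg ‖d‖)
    linarith
  have hCu : ∀ d, ‖d - μ • Q d‖ ^ 2 ≤ ‖d‖ ^ 2 := by
    intro d
    rw [norm_sub_sq_real, real_inner_smul_right, norm_smul, mul_pow, Real.norm_eq_abs, sq_abs]
    have a1 := mul_le_mul_of_nonneg_left (hQsq d) (sq_nonneg μ)
    have a2 := mul_le_mul_of_nonneg_right hμL.le (mul_nonneg hμ0.le (hQnn d))
    have a3 := mul_nonneg hμ0.le (hQnn d)
    linarith
  have hBinj : Function.Injective B.toLinearMap := by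
    rw [← LinearMap.ker_eq_bot, LinearMap.ker_eq_bot']
    intro x hx
    have hx' : B x = 0 := hx
    have h1 : ⟪x, B x⟫ = 0 := by rw [hx', inner_zero_right]
    rw [hBx, inner_add_right, real_inner_smul_right, real_inner_self_eq_norm_sq] at h1
    have h2 := mul_nonneg hμ0.le (hQnn x)
    have h5 : ‖x‖ = 0 := by nlinarith [norm_nonneg x, sq_nonneg ‖x‖]
    exact norm_eq_zero.1 h5
  set Re := LinearEquiv.ofInjectiveEndo B.toLinearMap hBinj with hRe
  set R : EuclideanSpace ℝ (Fin n) →L[ℝ] EuclideanSpace ℝ (Fin n) :=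
    LinearMap.toContinuousLinearMap Re.symm.toLinearMap with hR
  have hRB : ∀ x, R (B x) = x := fun x => Re.symm_apply_apply x
  have hBR : ∀ x, B (R x) = x := fun x => Re.apply_symm_apply x
  have hpf : ∀ v, B (proxf v) = v - μ • q := by
    intro v
    rw [hBx]
    refine aux_proxf Q hQsym q L hQL μ hμ0 (proxf v) v fun w => ?_
    have : f (proxf v) + ‖proxf v - v‖ ^ 2 / (2 * μ) ≤ f w + ‖w - v‖ ^ 2 / (2 * μ) :=
      hproxf v (mem_univ w)
    rwa [hf, hf] at this
  have hpf' : ∀ v, proxf v = R (v - μ • q) := fun v => by rw [← hpf, hRB]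
  set h : EuclideanSpace ℝ (Fin n) → ℝ := fun x => α * auxE Q q g μ proxg x with hh
  set K : ℝ := α * (L / 2 + 1 / (2 * μ)) with hK
  have hK0 : 0 < K := by positivity
  refine ⟨2 / (k ^ 2 * (1 - (μ * L) ^ 2)) * (K + 1 * (1 + ρ ^ 2)), by positivity, ?_⟩
  intro z v a xv hz hv _ hode hxv xs hxs
  have hxvR : ∀ t ∈ Ici (0 : ℝ), xv t = R (v t) := by
    intro t ht
    have h1 : HasDerivWithinAt (fun s => proxf (z s)) (R (v t)) (Ici 0) t := by
      simp only [hpf']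
      exact R.hasFDerivAt.comp_hasDerivWithinAt t ((hz t ht).sub_const _)
    exact (uniqueDiffOn_Ici (0 : ℝ) t ht).eq_deriv _ (hxv t ht) h1
  have hxa : ∀ t ∈ Ici (0 : ℝ), HasDerivWithinAt xv (R (a t)) (Ici 0) t := by
    intro t ht
    have h1 : HasDerivWithinAt (fun s => R (v s)) (R (a t)) (Ici 0) t :=
      R.hasFDerivAt.comp_hasDerivWithinAt t (hv t ht)
    exact h1.congr hxvR (hxvR t ht)
  refine aux_lyap S hSsym h (fun x => α • C (G x)) xs k K (1 - (μ * L) ^ 2) 1 γ β ρ hk0 hk1 hK0.le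
    hs0 hSl zero_le_one hSu ?_ ?_ ?_ hβ0 hβ1 hρ' hγβ (fun s => proxf (z s)) xv (fun s => R (a s))
    hxv hxa ?_
  · intro x y
    have h1 := (aux_env Q hQsym q g hgconv μ hμ0 proxg hproxg x y (G x) (hG' x)).1
    have h2 := hspec (y - x)
    simp only [hh, real_inner_smul_left, hCsym, hk2]
    rw [hCx]
    have h3 := mul_le_mul_of_nonneg_left h1 hα.le
    have h4 := mul_le_mul_of_nonneg_left h2 hα.le
    linarith
  · intro x y
    have h1 := (aux_env Q hQsym q g hgconv μ hμ0 proxg hproxg x y (G x) (hG' x)).2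
    simp only [hh, real_inner_smul_left, hCsym]
    rw [hCx]
    have h2 : ‖y - x - μ • Q (y - x)‖ ^ 2 / (2 * μ) ≤ ‖y - x‖ ^ 2 / (2 * μ) :=
      div_le_div_of_nonneg_right (hCu _) (by positivity)
    have h3 : 0 ≤ μ * ‖Q (y - x)‖ ^ 2 := by positivity
    have h4 := hQL (y - x)
    have h5 : auxE Q q g μ proxg y ≤ auxE Q q g μ proxg x + ⟪G x, y - x - μ • Q (y - x)⟫
      + (L / 2 + 1 / (2 * μ)) * ‖y - x‖ ^ 2 := by
      have : ‖y - x‖ ^ 2 / (2 * μ) = 1 / (2 * μ) * ‖y - x‖ ^ 2 := by ring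
      linarith
    have h6 := mul_le_mul_of_nonneg_left h5 hα.le
    rw [hK]
    linarith
  · have h1 := aux_fix Q hQsym q g L hQL hgconv μ hμ0 proxg hproxg xs (fun w => by
      have : F xs ≤ F w := hxs (mem_univ w)
      rw [hF, hF, hf, hf] at this
      linarith)
    simp only [hG', h1, sub_self, smul_zero, map_zero]
  · intro t ht
    have e1 : proxf (z t + β • v t) = proxf (z t) + β • xv t := by
      rw [hxvR t ht, hpf', hpf', ← map_smul, ← map_add]
      congr 1; abel
    have h1 := hode t ht
    rw [e1] at h1
    have h2 := congrArg C h1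
    simp only [map_add, map_smul, map_zero] at h2
    have e2 : S (R (a t)) = C (a t) := by
      simp only [hSdef, ContinuousLinearMap.comp_apply, hBR]
    have e3 : S (xv t) = C (v t) := by
      rw [hxvR t ht]
      simp only [hSdef, ContinuousLinearMap.comp_apply, hBR]
    rw [e2, e3]
    exact h2
end
end
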